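/- Let η be the infinite sequence of rationals in [0,1] formed by concatenating, over the primes p = 2, 3, 5, 7, ... in increasing order, the blocks (1⁻¹ mod p)/p, (2⁻¹ mod p)/p, ..., ((p−1)⁻¹ mod p)/p. Then liminf_{N→∞} √(N ln N) · D_N*(η) ≥ 1/2. In particular, the convergence rate D_N*(η) = O(1/√(N ln N)) is sharp. -/

import Mathlib

open Filter Finset
open scoped BigOperators Classical

/-- `starCount ξ N r` = number of indices `n` with `1 ≤ n ≤ N` and `ξ n ∈ [0, r]`
(counted with multiplicity). -/
noncomputable def starCount (ξ : ℕ → ℝ) (N : ℕ) (r : ℝ) : ℕ :=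
  ((Finset.Icc 1 N).filter (fun n => ξ n ∈ Set.Icc (0 : ℝ) r)).card

/-- Star discrepancy of the first `N` terms of the sequence `ξ` (indexed from 1):
`D_N*(ξ) = sup_{0 < r ≤ 1} |A_N(ξ, r)/N − r|`. -/
noncomputable def starDisc (ξ : ℕ → ℝ) (N : ℕ) : ℝ :=
  sSup {d : ℝ | ∃ r : ℝ, 0 < r ∧ r ≤ 1 ∧ d = |(starCount ξ N r : ℝ) / (N : ℝ) - r|}

/-- The `m`-th prime number, 1-indexed: `nthPrime 1 = 2`, `nthPrime 2 = 3`, … -/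
noncomputable def nthPrime (m : ℕ) : ℕ := Nat.nth Nat.Prime (m - 1)

/-- `Psum m = ∑_{k=1}^m (p_k − 1)`, the number of terms in the first `m` blocks of `η`. -/
noncomputable def Psum (m : ℕ) : ℕ := ∑ k ∈ Finset.Icc 1 m, (nthPrime k - 1)

/-- `invMod j p` = the representative in `{0, …, p−1}` of `j⁻¹ (mod p)`. -/
noncomputable def invMod (j p : ℕ) : ℕ := ((j : ZMod p)⁻¹).val

/-- The sequence `η` (indexed from 1), obtained by concatenating over the primes
`p = 2, 3, 5, …` the blocks `(j⁻¹ mod p)/p` for `j = 1, …, p−1`.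
For `n ≥ 1`, if `m` is minimal with `n ≤ Psum (m+1)` (so `Psum m < n ≤ Psum (m+1)`),
then `η n` is the `(n − Psum m)`-th element of the block for the prime `nthPrime (m+1)`. -/
noncomputable def eta (n : ℕ) : ℝ :=
  if h : ∃ m, n ≤ Psum (m + 1) then
    (invMod (n - Psum (Nat.find h)) (nthPrime (Nat.find h + 1)) : ℝ) /
      (nthPrime (Nat.find h + 1) : ℝ)
  else 0


lemma nthPrime_prime (k : ℕ) : (nthPrime k).Prime := Nat.prime_nth_prime _

lemma nthPrime_mono : Monotone nthPrime := by
  intro a b h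
  exact (Nat.nth_monotone Nat.infinite_setOfPred_prime) (by omega)

lemma Psum_succ (m : ℕ) : Psum (m + 1) = Psum m + (nthPrime (m + 1) - 1) := by
  unfold Psum
  rw [Finset.sum_Icc_succ_top (by omega)]

lemma Psum_mono : Monotone Psum := by
  apply monotone_nat_of_le_succ
  intro n
  rw [Psum_succ]
  omega

lemma le_Psum (m : ℕ) : m ≤ Psum m := by
  induction m with
  | zero => simp
  | succ k ih =>
    rw [Psum_succ]
    have := (nthPrime_prime (k + 1)).two_le
    omega

lemma invMod_lt (j k : ℕ) : invMod j (nthPrime k) < nthPrime k := by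
  have : NeZero (nthPrime k) := ⟨(nthPrime_prime k).ne_zero⟩
  exact ZMod.val_lt _

lemma eta_nonneg (n : ℕ) : 0 ≤ eta n := by
  unfold eta
  split_ifs
  · positivity
  · exact le_rfl

lemma eta_le (n m : ℕ) (h1 : 1 ≤ n) (h : n ≤ Psum m) : eta n ≤ 1 - 1 / (nthPrime m : ℝ) := by
  obtain ⟨k, rfl⟩ : ∃ k, m = k + 1 := by
    cases m with
    | zero => simp [Psum] at h; omega
    | succ k => exact ⟨k, rfl⟩
  have hex : ∃ m, n ≤ Psum (m + 1) := ⟨k, h⟩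
  unfold eta
  rw [dif_pos hex]
  have hf : Nat.find hex ≤ k := Nat.find_min' hex h
  set i := Nat.find hex
  have hp : (0 : ℝ) < nthPrime (i + 1) := by exact_mod_cast (nthPrime_prime _).pos
  have hle : (nthPrime (i + 1) : ℝ) ≤ nthPrime (k + 1) := by
    exact_mod_cast nthPrime_mono (by omega)
  have hlt : (invMod (n - Psum i) (nthPrime (i + 1)) : ℝ) + 1 ≤ nthPrime (i + 1) := by
    exact_mod_cast invMod_lt _ _
  calc _ ≤ ((nthPrime (i + 1) : ℝ) - 1) / nthPrime (i + 1) := by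
        gcongr; linarith
    _ = 1 - 1 / (nthPrime (i + 1) : ℝ) := by field_simp
    _ ≤ _ := by gcongr

lemma starCount_le (ξ : ℕ → ℝ) (N : ℕ) (r : ℝ) : starCount ξ N r ≤ N := by
  unfold starCount
  exact (Finset.card_filter_le _ _).trans (by simp)

lemma starDisc_bdd (ξ : ℕ → ℝ) (N : ℕ) :
    BddAbove {d : ℝ | ∃ r : ℝ, 0 < r ∧ r ≤ 1 ∧ d = |(starCount ξ N r : ℝ) / (N : ℝ) - r|} := by
  refine ⟨1, ?_⟩
  rintro d ⟨r, h0, h1, rfl⟩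
  have : (starCount ξ N r : ℝ) / N ≤ 1 :=
    div_le_one_of_le₀ (by exact_mod_cast starCount_le ξ N r) (by positivity)
  have h2 : 0 ≤ (starCount ξ N r : ℝ) / N := by positivity
  rw [abs_le]
  constructor <;> linarith

lemma starDisc_ge (N m : ℕ) (hN : 1 ≤ N) (h : N ≤ Psum m) :
    1 / (nthPrime m : ℝ) ≤ starDisc eta N := by
  have h2 : (2 : ℝ) ≤ nthPrime m := by exact_mod_cast (nthPrime_prime m).two_le
  have hp : 1 / (nthPrime m : ℝ) ≤ 1 / 2 := by gcongr
  have hp0 : 0 < 1 / (nthPrime m : ℝ) := by positivity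
  apply le_csSup (starDisc_bdd _ _)
  refine ⟨1 - 1 / (nthPrime m : ℝ), by linarith, by linarith, ?_⟩
  have : starCount eta N (1 - 1 / (nthPrime m : ℝ)) = N := by
    unfold starCount
    rw [Finset.filter_true_of_mem]
    · simp
    · intro n hn
      rw [Finset.mem_Icc] at hn
      exact ⟨eta_nonneg n, eta_le n m hn.1 (hn.2.trans h)⟩
  rw [this, div_self (by positivity)]
  rw [abs_of_nonneg (by linarith)]
  ring

lemma eta_block (m j : ℕ) (h1 : 1 ≤ j) (h2 : j ≤ nthPrime (m + 1) - 1) :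
    eta (Psum m + j) = (invMod j (nthPrime (m + 1)) : ℝ) / nthPrime (m + 1) := by
  have hex : ∃ k, Psum m + j ≤ Psum (k + 1) := ⟨m, by rw [Psum_succ]; omega⟩
  have hf : Nat.find hex = m := by
    rw [Nat.find_eq_iff]
    refine ⟨by rw [Psum_succ]; omega, fun k hk hle => ?_⟩
    have := Psum_mono (show k + 1 ≤ m by omega)
    omega
  unfold eta
  rw [dif_pos hex, hf]
  simp

lemma invMod_invol (p j : ℕ) (hp : p.Prime) (hj : j ∈ Finset.Icc 1 (p - 1)) :
    invMod j p ∈ Finset.Icc 1 (p - 1) ∧ invMod (invMod j p) p = j := by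
  have : Fact p.Prime := ⟨hp⟩
  rw [Finset.mem_Icc] at hj
  have hp2 := hp.two_le
  have hj0 : (j : ZMod p) ≠ 0 := by
    rw [Ne, ZMod.natCast_eq_zero_iff]
    exact Nat.not_dvd_of_pos_of_lt (by omega) (by omega)
  have hlt : invMod j p < p := ZMod.val_lt _
  have hne : invMod j p ≠ 0 := by
    unfold invMod
    rw [Ne, ZMod.val_eq_zero]
    exact inv_ne_zero hj0
  refine ⟨Finset.mem_Icc.2 ⟨by omega, by omega⟩, ?_⟩
  unfold invMod
  rw [ZMod.natCast_zmod_val, inv_inv, ZMod.val_natCast, Nat.mod_eq_of_lt (by omega)]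

lemma block_card (p : ℕ) (hp : p.Prime) (r : ℝ) :
    ((Finset.Icc 1 (p - 1)).filter (fun j => (invMod j p : ℝ) / p ≤ r)).card =
    ((Finset.Icc 1 (p - 1)).filter (fun j : ℕ => (j : ℝ) / p ≤ r)).card := by
  apply Finset.card_nbij' (fun j => invMod j p) (fun j => invMod j p)
  · intro j hj
    simp only [Finset.coe_filter, Set.mem_ofPred_eq] at hj ⊢
    exact ⟨(invMod_invol p j hp hj.1).1, hj.2⟩
  · intro j hj
    simp only [Finset.coe_filter, Set.mem_ofPred_eq] at hj ⊢
    have := invMod_invol p j hp hj.1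
    refine ⟨this.1, ?_⟩
    rw [this.2]; exact hj.2
  · intro j hj
    simp only [Finset.coe_filter, Set.mem_ofPred_eq] at hj
    exact (invMod_invol p j hp hj.1).2
  · intro j hj
    simp only [Finset.coe_filter, Set.mem_ofPred_eq] at hj
    exact (invMod_invol p j hp hj.1).2

lemma block_disc (p : ℕ) (hp : p.Prime) (r : ℝ) (h0 : 0 < r) (h1 : r ≤ 1) :
    |(((Finset.Icc 1 (p - 1)).filter (fun j => (invMod j p : ℝ) / p ≤ r)).card : ℝ)
      - r * ((p - 1 : ℕ) : ℝ)| ≤ 1 := by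
  rw [block_card p hp r]
  have hp0 : (0 : ℝ) < p := by exact_mod_cast hp.pos
  have : (Finset.Icc 1 (p - 1)).filter (fun j : ℕ => (j : ℝ) / p ≤ r)
      = Finset.Icc 1 (min (p - 1) ⌊r * p⌋₊) := by
    ext j
    simp only [Finset.mem_filter, Finset.mem_Icc, le_min_iff]
    rw [Nat.le_floor_iff (by positivity), div_le_iff₀ hp0]
    tauto
  rw [this, Nat.card_Icc, Nat.add_sub_cancel]
  have hc : ((p - 1 : ℕ) : ℝ) = p - 1 := by rw [Nat.cast_sub hp.one_le]; simp
  have hf1 := Nat.floor_le (show 0 ≤ r * p by positivity)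
  have hf2 := Nat.lt_floor_add_one (r * p)
  rw [Nat.cast_min, hc]
  have hp1 : (1 : ℝ) ≤ p := by exact_mod_cast hp.one_le
  rw [abs_le]
  rcases min_cases ((p : ℝ) - 1) (⌊r * p⌋₊ : ℝ) with h | h <;> rw [h.1]
  · constructor <;> nlinarith [h.2]
  · constructor <;> nlinarith [h.2]

lemma starCount_Psum_succ (m : ℕ) (r : ℝ) :
    starCount eta (Psum (m + 1)) r = starCount eta (Psum m) r +
    ((Finset.Icc 1 (nthPrime (m + 1) - 1)).filter
      (fun j => (invMod j (nthPrime (m + 1)) : ℝ) / nthPrime (m + 1) ≤ r)).card := by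
  unfold starCount
  rw [Psum_succ]
  set b := nthPrime (m + 1) - 1 with hb
  have hU : (Finset.Icc 1 (Psum m + b)).filter (fun n => eta n ∈ Set.Icc 0 r) =
      (Finset.Icc 1 (Psum m)).filter (fun n => eta n ∈ Set.Icc 0 r) ∪
      ((Finset.Icc 1 b).filter (fun j =>
        (invMod j (nthPrime (m + 1)) : ℝ) / nthPrime (m + 1) ≤ r)).image (fun j => Psum m + j) := by
    ext n
    simp only [Finset.mem_filter, Finset.mem_union, Finset.mem_image, Finset.mem_Icc]
    constructor
    · rintro ⟨⟨ha, hc⟩, hd⟩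
      by_cases hn : n ≤ Psum m
      · exact Or.inl ⟨⟨ha, hn⟩, hd⟩
      · right
        refine ⟨n - Psum m, ⟨⟨by omega, by omega⟩, ?_⟩, by omega⟩
        rw [← eta_block m (n - Psum m) (by omega) (by omega)]
        rw [show Psum m + (n - Psum m) = n by omega]
        exact hd.2
    · rintro (⟨⟨ha, hc⟩, hd⟩ | ⟨j, ⟨⟨ha, hc⟩, hd⟩, rfl⟩)
      · exact ⟨⟨ha, by omega⟩, hd⟩
      · refine ⟨⟨by omega, by omega⟩, eta_nonneg _, ?_⟩
        rw [eta_block m j ha hc]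
        exact hd
  rw [hU, Finset.card_union_of_disjoint, Finset.card_image_of_injective]
  · intro a b h
    simpa using h
  · rw [Finset.disjoint_left]
    intro n hn hn'
    simp only [Finset.mem_filter, Finset.mem_image, Finset.mem_Icc] at hn hn'
    obtain ⟨j, hj, rfl⟩ := hn'
    omega

lemma count_disc (m : ℕ) (r : ℝ) (h0 : 0 < r) (h1 : r ≤ 1) :
    |(starCount eta (Psum m) r : ℝ) - r * (Psum m : ℝ)| ≤ m := by
  induction m with
  | zero => simp [starCount, Psum]
  | succ k ih =>
    rw [starCount_Psum_succ, Psum_succ]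
    have := block_disc _ (nthPrime_prime (k + 1)) r h0 h1
    rw [abs_le] at *
    push_cast at *
    constructor <;> linarith [this.1, this.2, ih.1, ih.2]

lemma starDisc_le (m : ℕ) (hm : 1 ≤ m) : starDisc eta (Psum m) ≤ m / (Psum m : ℝ) := by
  have hP : (0 : ℝ) < Psum m := by exact_mod_cast lt_of_lt_of_le hm (le_Psum m)
  unfold starDisc
  refine csSup_le ⟨_, 1, one_pos, le_rfl, rfl⟩ ?_
  rintro d ⟨r, h0, h1, rfl⟩
  have := count_disc m r h0 h1
  have he : (starCount eta (Psum m) r : ℝ) / Psum m - r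
      = ((starCount eta (Psum m) r : ℝ) - r * (Psum m : ℝ)) / Psum m := by field_simp
  rw [he, abs_div, abs_of_pos hP]
  gcongr

lemma pi_nthPrime (k : ℕ) : Nat.primeCounting (nthPrime (k + 1)) = k + 1 := by
  unfold nthPrime Nat.primeCounting Nat.primeCounting'
  rw [Nat.count_succ]
  simp [Nat.count_nth_of_infinite Nat.infinite_setOfPred_prime]

lemma lt_nthPrime (k : ℕ) : k < nthPrime k := by
  have := Nat.add_two_le_nth_prime (k - 1)
  unfold nthPrime
  omega

lemma tendsto_nthPrime : Tendsto (fun k : ℕ => (nthPrime k : ℝ)) atTop atTop := by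
  apply tendsto_atTop_mono (f := fun k : ℕ => (k : ℝ)) _ tendsto_natCast_atTop_atTop
  intro k
  exact_mod_cast (lt_nthPrime k).le

lemma ev_mul_log_le : ∀ᶠ k : ℕ in atTop, (k : ℝ) * Real.log k ≤ 1.4 * nthPrime k := by
  have h4 : Real.log 4 < 1.39 := by
    rw [show (4 : ℝ) = 2 ^ 2 by norm_num, Real.log_pow]
    have := Real.log_two_lt_d9
    norm_num
    linarith
  have h := tendsto_nthPrime.eventually
    (Chebyshev.eventually_primeCounting_le (ε := 0.01) (by norm_num))
  filter_upwards [h, eventually_ge_atTop 2] with k hk hk2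
  obtain ⟨i, rfl⟩ : ∃ i, k = i + 1 := ⟨k - 1, by omega⟩
  rw [Nat.floor_natCast, pi_nthPrime] at hk
  set x : ℝ := (nthPrime (i + 1) : ℝ) with hx
  set n : ℝ := ((i + 1 : ℕ) : ℝ) with hn
  have hn2 : (2 : ℝ) ≤ n := by rw [hn]; exact_mod_cast hk2
  have hnx : n ≤ x := by rw [hn, hx]; exact_mod_cast (lt_nthPrime (i + 1)).le
  have hlog : Real.log n ≤ Real.log x := Real.log_le_log (by linarith) hnx
  have hl0 : 0 < Real.log x := Real.log_pos (by linarith)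
  rw [le_div_iff₀ hl0] at hk
  calc n * Real.log n ≤ n * Real.log x := by gcongr
    _ ≤ _ := hk
    _ ≤ _ := by gcongr; linarith

lemma Psum_lower : ∃ C : ℝ, ∀ n : ℕ, (n : ℝ) ^ 2 / 2 * Real.log n - C * n ^ 2 ≤ 1.4 * Psum n := by
  obtain ⟨K, hK⟩ := eventually_atTop.1 ev_mul_log_le
  have hK' : ∀ k : ℕ, 1 ≤ k → (k : ℝ) * Real.log k - K * Real.log K ≤ 1.4 * nthPrime k := by
    intro k hk1
    have hk1' : (1 : ℝ) ≤ k := by exact_mod_cast hk1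
    by_cases hk : K ≤ k
    · have : 0 ≤ (K : ℝ) * Real.log K := by positivity
      linarith [hK k hk]
    · have hkK : (k : ℝ) ≤ K := by exact_mod_cast (not_le.1 hk).le
      have : (k : ℝ) * Real.log k ≤ K * Real.log K := by
        gcongr
      have : (0 : ℝ) ≤ nthPrime k := by positivity
      linarith
  set D : ℝ := K * Real.log K with hD
  have hD0 : 0 ≤ D := by positivity
  refine ⟨D + 2.4, fun n => ?_⟩
  rcases Nat.eq_zero_or_pos n with rfl | hn
  · simp [Psum]
  have hn1 : (1 : ℝ) ≤ n := by exact_mod_cast hn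
  have hterm : ∀ k ∈ Finset.Icc 1 n, (k : ℝ) * Real.log n - n - D - 1.4
      ≤ 1.4 * ((nthPrime k - 1 : ℕ) : ℝ) := by
    intro k hk
    rw [Finset.mem_Icc] at hk
    have hk1 : (1 : ℝ) ≤ k := by exact_mod_cast hk.1
    have h1 := hK' k hk.1
    have h2 : Real.log ((n : ℝ) / k) ≤ n / k := Real.log_le_self (by positivity)
    rw [Real.log_div (by positivity) (by positivity)] at h2
    have h3 : (k : ℝ) * (Real.log n - Real.log k) ≤ k * (n / k) := by gcongr
    rw [mul_div_cancel₀ _ (by positivity)] at h3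
    rw [Nat.cast_sub (nthPrime_prime k).one_le]
    push_cast
    linarith
  have hs := Finset.sum_le_sum hterm
  rw [← Finset.mul_sum] at hs
  have hPs : ∑ k ∈ Finset.Icc 1 n, ((nthPrime k - 1 : ℕ) : ℝ) = Psum n := by
    unfold Psum; push_cast; rfl
  rw [hPs] at hs
  have hg : ∀ m : ℕ, ∑ k ∈ Finset.Icc 1 m, (k : ℝ) = m * (m + 1) / 2 := by
    intro m
    induction m with
    | zero => simp
    | succ i ih => rw [Finset.sum_Icc_succ_top (by omega), ih]; push_cast; ring
  simp only [Finset.sum_sub_distrib, ← Finset.sum_mul, hg, Finset.sum_const, Nat.card_Icc,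
    nsmul_eq_mul, Nat.add_sub_cancel] at hs
  have hl : 0 ≤ Real.log n := Real.log_nonneg hn1
  have : (n : ℝ) ≤ n ^ 2 := by nlinarith
  nlinarith [mul_nonneg hD0 (sub_nonneg.2 this), mul_nonneg (by positivity : (0 : ℝ) ≤ n) hl]

lemma ev_Psum : ∀ᶠ n : ℕ in atTop, 0.35 * (n : ℝ) ^ 2 * Real.log n ≤ Psum n := by
  obtain ⟨C, hC⟩ := Psum_lower
  have : Tendsto (fun n : ℕ => Real.log n) atTop atTop :=
    Real.tendsto_log_atTop.comp tendsto_natCast_atTop_atTop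
  filter_upwards [this.eventually_ge_atTop (100 * C)] with n hn
  have := hC n
  nlinarith [sq_nonneg (n : ℝ)]

lemma ev_real : ∀ᶠ x : ℝ in atTop,
    0.69 * x / Real.log x ≤ (x * Real.log 2 - Real.log (x + 1)) / Real.log x - 1 ∧
    0.99 * Real.log x ≤ Real.log (0.69 * x / Real.log x) := by
  have h1 := Real.isLittleO_log_id_atTop.bound (show (0 : ℝ) < 0.0001 by norm_num)
  have h2 := (isLittleO_log_rpow_atTop (show (0 : ℝ) < 0.01 by norm_num)).bound
    (show (0 : ℝ) < 0.69 by norm_num)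
  filter_upwards [h1, h2, eventually_ge_atTop 100000] with x h1 h2 hx
  have hl : 0 < Real.log x := Real.log_pos (by linarith)
  have hx0 : 0 < x := by linarith
  simp only [id, Real.norm_eq_abs] at h1 h2
  rw [abs_of_pos hl, abs_of_pos hx0] at h1
  rw [abs_of_pos hl, abs_of_pos (by positivity)] at h2
  constructor
  · rw [div_sub_one hl.ne']
    gcongr
    have h3 : Real.log (x + 1) ≤ Real.log (2 * x) := Real.log_le_log (by linarith) (by linarith)
    rw [Real.log_mul (by norm_num) hx0.ne'] at h3
    have := Real.log_two_gt_d9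
    have := Real.log_two_lt_d9
    nlinarith
  · rw [← Real.log_rpow hx0]
    apply Real.log_le_log (by positivity)
    rw [le_div_iff₀ hl]
    calc x ^ (0.99 : ℝ) * Real.log x ≤ x ^ (0.99 : ℝ) * (0.69 * x ^ (0.01 : ℝ)) := by gcongr
      _ = 0.69 * (x ^ (0.99 : ℝ) * x ^ (0.01 : ℝ)) := by ring
      _ = 0.69 * x := by
        rw [← Real.rpow_add hx0]; norm_num

lemma ev_index : ∀ᶠ n : ℕ in atTop,
    0.69 * (nthPrime (n + 1) : ℝ) / Real.log (nthPrime (n + 1)) ≤ n ∧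
    0.99 * Real.log (nthPrime (n + 1)) ≤ Real.log n := by
  have := (tendsto_nthPrime.comp (tendsto_add_atTop_nat 1)).eventually ev_real
  filter_upwards [this] with n hn
  simp only [Function.comp] at hn
  have hp := Chebyshev.pi_ge (nthPrime (n + 1))
  rw [pi_nthPrime] at hp
  push_cast at hp
  have h1 : 0.69 * (nthPrime (n + 1) : ℝ) / Real.log (nthPrime (n + 1)) ≤ n := by
    linarith [hn.1]
  refine ⟨h1, hn.2.trans (Real.log_le_log ?_ h1)⟩
  have h2 : (1 : ℝ) < nthPrime (n + 1) := by exact_mod_cast (nthPrime_prime _).one_lt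
  have := Real.log_pos h2
  positivity

lemma ev_lower : ∀ᶠ N : ℕ in atTop,
    (1 / 2 : ℝ) ≤ Real.sqrt ((N : ℝ) * Real.log N) * starDisc eta N := by
  have hlogt : Tendsto (fun n : ℕ => Real.log n) atTop atTop :=
    Real.tendsto_log_atTop.comp tendsto_natCast_atTop_atTop
  obtain ⟨n0, hn0⟩ := eventually_atTop.1
    ((ev_Psum.and ev_index).and (hlogt.eventually_ge_atTop 10))
  filter_upwards [eventually_gt_atTop (Psum n0)] with N hN
  have hex : ∃ m, N ≤ Psum (m + 1) := ⟨N, (by omega : N ≤ N + 1).trans (le_Psum _)⟩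
  obtain ⟨n, hle, hmin⟩ : ∃ n, N ≤ Psum (n + 1) ∧ Psum n < N := by
    refine ⟨Nat.find hex, Nat.find_spec hex, ?_⟩
    by_contra hcon
    rcases Nat.eq_zero_or_pos (Nat.find hex) with h0 | h0
    · rw [h0] at hcon
      simp [Psum] at hcon
      omega
    · have := Nat.find_min hex (m := Nat.find hex - 1) (by omega)
      rw [Nat.sub_add_cancel h0] at this
      omega
  have hnn : n0 ≤ n := by
    by_contra hcon
    have := Psum_mono (show n + 1 ≤ n0 by omega)
    omega
  obtain ⟨⟨hP, hi1, hi2⟩, hlog⟩ := hn0 n hnn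
  have hd := starDisc_ge N (n + 1) (by omega) hle
  set x : ℝ := (nthPrime (n + 1) : ℝ) with hx
  have hx1 : 1 < x := by rw [hx]; exact_mod_cast (nthPrime_prime _).one_lt
  have hlx : 0 < Real.log x := Real.log_pos hx1
  have hn1 : (1 : ℝ) ≤ n := by
    by_contra hcon
    have : n = 0 := by
      by_contra h; exact hcon (by exact_mod_cast Nat.one_le_iff_ne_zero.2 h)
    subst this
    simp at hlog
    linarith
  have hNP : (Psum n : ℝ) ≤ N := by exact_mod_cast hmin.le
  have hNn : 0.35 * (n : ℝ) ^ 2 * Real.log n ≤ N := hP.trans hNP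
  have hN2 : (n : ℝ) ^ 2 ≤ N := by nlinarith [sq_nonneg (n : ℝ)]
  have hlN : 2 * Real.log n ≤ Real.log N := by
    have := Real.log_le_log (by positivity) hN2
    rw [Real.log_pow] at this
    exact_mod_cast this
  have hnl : 0.683 * x ≤ n * Real.log n := by
    rw [div_le_iff₀ hlx] at hi1
    have : (n : ℝ) * (0.99 * Real.log x) ≤ n * Real.log n := by gcongr
    nlinarith
  have hprod : (x / 2) ^ 2 ≤ (N : ℝ) * Real.log N := by
    calc (x / 2) ^ 2 ≤ 0.7 * (0.683 * x) ^ 2 := by nlinarith [sq_nonneg x]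
      _ ≤ 0.7 * (n * Real.log n) ^ 2 := by gcongr
      _ = (0.35 * (n : ℝ) ^ 2 * Real.log n) * (2 * Real.log n) := by ring
      _ ≤ _ := by gcongr
  have hs : x / 2 ≤ Real.sqrt ((N : ℝ) * Real.log N) := Real.le_sqrt_of_sq_le hprod
  calc (1 / 2 : ℝ) = x / 2 * (1 / x) := by field_simp
    _ ≤ _ := by gcongr

lemma Psum_le_sq (n : ℕ) : Psum n ≤ (nthPrime (n + 1)) ^ 2 := by
  have h : Psum n ≤ n * nthPrime (n + 1) := by
    unfold Psum
    calc _ ≤ ∑ k ∈ Finset.Icc 1 n, nthPrime (n + 1) := by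
          apply Finset.sum_le_sum
          intro k hk
          rw [Finset.mem_Icc] at hk
          have := nthPrime_mono (show k ≤ n + 1 by omega)
          omega
      _ = _ := by simp
  have := lt_nthPrime (n + 1)
  nlinarith

lemma ev_upper : ∀ᶠ n : ℕ in atTop,
    Real.sqrt ((Psum n : ℝ) * Real.log (Psum n)) * starDisc eta (Psum n) ≤ 4 := by
  have hlogt : Tendsto (fun n : ℕ => Real.log n) atTop atTop :=
    Real.tendsto_log_atTop.comp tendsto_natCast_atTop_atTop
  filter_upwards [ev_Psum, ev_index, hlogt.eventually_ge_atTop 10, eventually_ge_atTop 1]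
    with n hP hi hlog hn
  have hn1 : (1 : ℝ) ≤ n := by exact_mod_cast hn
  have hd := starDisc_le n hn
  have hds : 0 ≤ starDisc eta (Psum n) :=
    le_trans (by positivity) (starDisc_ge (Psum n) n (hn.trans (le_Psum n)) le_rfl)
  have hN0 : (0 : ℝ) < Psum n := by exact_mod_cast lt_of_lt_of_le hn (le_Psum n)
  have hsq : (Psum n : ℝ) ≤ (nthPrime (n + 1) : ℝ) ^ 2 := by exact_mod_cast Psum_le_sq n
  have hl := Real.log_le_log hN0 hsq
  rw [Real.log_pow] at hl
  push_cast at hl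
  set N : ℝ := (Psum n : ℝ)
  have hl2 : Real.log N ≤ 3 * Real.log n := by linarith [hi.2]
  have hb : Real.sqrt (N * Real.log N) ≤ 4 * N / n := by
    apply Real.sqrt_le_iff.2
    refine ⟨by positivity, ?_⟩
    rw [div_pow, le_div_iff₀ (by positivity)]
    have : Real.log N * (n : ℝ) ^ 2 ≤ 16 * N := by
      nlinarith [mul_le_mul_of_nonneg_right hl2 (sq_nonneg (n : ℝ))]
    nlinarith
  calc _ ≤ 4 * N / n * (n / N) := mul_le_mul hb hd hds (by positivity)
    _ = 4 := by field_simp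

/-- `liminf_{N→∞} √(N ln N) · D_N*(η) ≥ 1/2`. -/
theorem eta_starDisc_liminf :
    (1 / 2 : ℝ) ≤
      Filter.liminf (fun N : ℕ => Real.sqrt ((N : ℝ) * Real.log N) * starDisc eta N)
        Filter.atTop := by
  have hP : Tendsto Psum atTop atTop := tendsto_atTop_mono le_Psum tendsto_id
  have hfreq : ∃ᶠ N : ℕ in atTop,
      Real.sqrt ((N : ℝ) * Real.log N) * starDisc eta N ≤ 4 :=
    hP.frequently ev_upper.frequently
  exact le_liminf_of_le (Filter.IsCoboundedUnder.of_frequently_le hfreq) ev_lower
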